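/- Let n_1,…,n_p ∈ ℕ with N := n_1 + … + n_p ≥ 2. The number of words of length N over the alphabet Fin p containing exactly n_i occurrences of letter i for each i, and whose first two letters are distinct, equals (N! / (n_1! ⋯ n_p!)) · (N² − Σ_{i=1}^p n_i²) / (N(N−1)). -/

import Mathlib

open Finset in
/-- The words with prescribed occurrence counts. -/
def wordsWith (p N : ℕ) (n : Fin p → ℕ) : Finset (Fin N → Fin p) :=
  univ.filter (fun w => ∀ i : Fin p, (univ.filter (fun j : Fin N => w j = i)).card = n i)

open Finset in
theorem card_wordsWith (p N : ℕ) (n : Fin p → ℕ) (hN : N = ∑ i, n i) :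
    (wordsWith p N n).card = Nat.multinomial univ n := by
  have hT : Fintype.card (Fin N) = Fintype.card (Σ i, Fin (n i)) := by simp [hN]
  have e₀ : Fin N ≃ (Σ i, Fin (n i)) := Fintype.equivOfCardEq hT
  have key : (univ : Finset (Fin N ≃ Σ i, Fin (n i))).card =
      ∑ w ∈ wordsWith p N n,
        (univ.filter (fun e : Fin N ≃ Σ i, Fin (n i) => (fun j => (e j).1) = w)).card := by
    refine card_eq_sum_card_fiberwise ?_
    intro e _
    simp only [wordsWith, coe_filter, mem_univ, true_and, Set.mem_setOf_eq]
    intro i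
    rw [← Fintype.card_subtype]
    have : {j // (e j).1 = i} ≃ {t : (Σ i, Fin (n i)) // t.1 = i} :=
      e.subtypeEquiv (fun j => Iff.rfl)
    rw [Fintype.card_congr this, Fintype.card_congr (Equiv.sigmaSubtype i), Fintype.card_fin]
  have fib : ∀ w ∈ wordsWith p N n,
      (univ.filter (fun e : Fin N ≃ Σ i, Fin (n i) => (fun j => (e j).1) = w)).card
        = ∏ i, (n i).factorial := by
    intro w hw
    simp only [wordsWith, mem_filter, mem_univ, true_and] at hw
    have hfe : ∀ i, Nonempty ({j // w j = i} ≃ {t : (Σ i, Fin (n i)) // t.1 = i}) := by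
      intro i
      refine ⟨Fintype.equivOfCardEq ?_⟩
      rw [Fintype.card_congr (Equiv.sigmaSubtype i), Fintype.card_fin, Fintype.card_subtype, hw]
    let e₁ : Fin N ≃ Σ i, Fin (n i) := Equiv.ofFiberEquiv (fun i => (hfe i).some)
    have he₁ : ∀ j, (e₁ j).1 = w j := fun j => Equiv.ofFiberEquiv_map _ j
    have hs := DomMulAct.stabilizer_card w
    rw [← Fintype.card_subtype]
    have E : {g : Equiv.Perm (Fin N) // w ∘ g = w} ≃
        {e : Fin N ≃ Σ i, Fin (n i) // (fun j => (e j).1) = w} :=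
      (Equiv.equivCongr (Equiv.refl _) e₁).subtypeEquiv (fun g => by
        simp [funext_iff, he₁])
    rw [← Fintype.card_congr E, hs]
    refine prod_congr rfl fun i _ => ?_
    rw [Fintype.card_subtype, hw]
  rw [sum_congr rfl fib, sum_const, card_univ, Fintype.card_equiv e₀, Fintype.card_fin,
    smul_eq_mul] at key
  have hm := Nat.multinomial_spec univ n
  rw [← hN, key, mul_comm] at hm
  exact (Nat.eq_of_mul_eq_mul_right (prod_pos fun i _ => Nat.factorial_pos _) hm).symm

open Finset in
theorem card_pair_eq (p N : ℕ) (n : Fin p → ℕ) (a b c d : Fin N) (hab : a ≠ b) (hcd : c ≠ d) :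
    ((wordsWith p N n).filter (fun w => w a ≠ w b)).card =
      ((wordsWith p N n).filter (fun w => w c ≠ w d)).card := by
  obtain ⟨g, hga, hgb⟩ : ∃ g : Equiv.Perm (Fin N), g a = c ∧ g b = d := by
    refine ⟨(Equiv.swap a c).trans (Equiv.swap (Equiv.swap a c b) d), ?_, ?_⟩
    · have h1 : c ≠ Equiv.swap a c b := by
        intro h
        apply hab
        apply (Equiv.swap a c).injective
        rw [← h]; simp
      simp [Equiv.swap_apply_of_ne_of_ne h1 hcd]
    · simp
  have hcount : ∀ (h : Equiv.Perm (Fin N)) (w : Fin N → Fin p) (i : Fin p),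
      (univ.filter (fun j : Fin N => w (h j) = i)).card =
      (univ.filter (fun j : Fin N => w j = i)).card := by
    intro h w i
    rw [← Fintype.card_subtype, ← Fintype.card_subtype]
    exact Fintype.card_congr (h.subtypeEquiv (fun j => Iff.rfl))
  refine card_bij' (fun w _ => w ∘ g.symm) (fun w _ => w ∘ g) ?_ ?_ ?_ ?_
  · intro w hw
    simp only [wordsWith, mem_filter, mem_univ, true_and, Function.comp] at hw ⊢
    refine ⟨fun i => by rw [hcount g.symm]; exact hw.1 i, ?_⟩
    rw [← hga, ← hgb]; simpa using hw.2
  · intro w hw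
    simp only [wordsWith, mem_filter, mem_univ, true_and, Function.comp] at hw ⊢
    refine ⟨fun i => by rw [hcount g]; exact hw.1 i, ?_⟩
    rw [hga, hgb]; exact hw.2
  · intro w _; ext; simp
  · intro w _; ext; simp

open Finset in
theorem card_diff_pairs (p N : ℕ) (n : Fin p → ℕ) (w : Fin N → Fin p)
    (hw : w ∈ wordsWith p N n) :
    (univ.filter (fun x : Fin N × Fin N => w x.1 ≠ w x.2)).card = N ^ 2 - ∑ i, n i ^ 2 := by
  simp only [wordsWith, mem_filter, mem_univ, true_and] at hw
  have h1 := card_filter_add_card_filter_not (s := (univ : Finset (Fin N × Fin N)))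
    (fun x => w x.1 = w x.2)
  have h2 : (univ.filter (fun x : Fin N × Fin N => w x.1 = w x.2)).card = ∑ i, n i ^ 2 := by
    rw [card_eq_sum_card_fiberwise (f := fun x => w x.1) (t := univ) (by intro x _; simp)]
    refine sum_congr rfl fun i _ => ?_
    rw [← hw i, sq, ← card_product]
    congr 1
    ext x
    simp only [mem_filter, mem_univ, true_and, mem_product]
    constructor
    · rintro ⟨h, h'⟩; exact ⟨h', h ▸ h'⟩
    · rintro ⟨h, h'⟩; exact ⟨h.trans h'.symm, h⟩
  rw [h2, card_univ, Fintype.card_prod, Fintype.card_fin, ← sq] at h1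
  simp only [ne_eq]
  omega

/-- For `n_1, …, n_p ∈ ℕ` with `N = n_1 + … + n_p ≥ 2`, the number
of words of length `N` over the alphabet `Fin p` with exactly `n_i` occurrences of
letter `i` whose first two letters are distinct equals
`(N!/(n_1! ⋯ n_p!)) · (N² − Σ n_i²)/(N(N−1))`.
(Stated in product form to avoid truncated division.) -/
theorem count_words_first_two_distinct (p : ℕ) (n : Fin p → ℕ)
    (N : ℕ) (hN : N = ∑ i, n i) (hN2 : 2 ≤ N) :
    Nat.card {w : Fin N → Fin p //
        (∀ i : Fin p, (Finset.univ.filter (fun j : Fin N => w j = i)).card = n i) ∧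
        w ⟨0, by omega⟩ ≠ w ⟨1, by omega⟩} *
      (N * (N - 1)) =
    Nat.multinomial Finset.univ n * (N ^ 2 - ∑ i, n i ^ 2) := by
  classical
  set a : Fin N := ⟨0, by omega⟩
  set b : Fin N := ⟨1, by omega⟩
  have hab : a ≠ b := by simp [a, b]
  have hc : Nat.card {w : Fin N → Fin p //
        (∀ i : Fin p, (Finset.univ.filter (fun j : Fin N => w j = i)).card = n i) ∧
        w a ≠ w b} = ((wordsWith p N n).filter (fun w => w a ≠ w b)).card := by
    rw [Nat.card_eq_fintype_card, Fintype.card_subtype, wordsWith, Finset.filter_filter]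
  rw [hc]
  have hoff : (Finset.univ : Finset (Fin N)).offDiag.card = N * (N - 1) := by
    rw [Finset.offDiag_card, Finset.card_univ, Fintype.card_fin, Nat.mul_sub, mul_one]
  have hdc := Finset.sum_card_bipartiteAbove_eq_sum_card_bipartiteBelow
    (s := (Finset.univ : Finset (Fin N)).offDiag) (t := wordsWith p N n)
    (fun x w => w x.1 ≠ w x.2)
  have hl : ∀ x ∈ (Finset.univ : Finset (Fin N)).offDiag,
      (Finset.bipartiteAbove (fun (x : Fin N × Fin N) (w : Fin N → Fin p) => w x.1 ≠ w x.2)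
        (wordsWith p N n) x).card =
      ((wordsWith p N n).filter (fun w => w a ≠ w b)).card := by
    intro x hx
    exact card_pair_eq p N n _ _ _ _ (Finset.mem_offDiag.1 hx).2.2 hab
  have hr : ∀ w ∈ wordsWith p N n,
      (Finset.bipartiteBelow (fun (x : Fin N × Fin N) (w : Fin N → Fin p) => w x.1 ≠ w x.2)
        (Finset.univ : Finset (Fin N)).offDiag w).card = N ^ 2 - ∑ i, n i ^ 2 := by
    intro w hw
    rw [← card_diff_pairs p N n w hw]
    congr 1
    ext x
    simp only [Finset.bipartiteBelow, Finset.mem_filter, Finset.mem_offDiag, Finset.mem_univ,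
      true_and, and_iff_right_iff_imp]
    intro h h'
    exact h (by rw [h'])
  rw [Finset.sum_congr rfl hl, Finset.sum_congr rfl hr, Finset.sum_const, Finset.sum_const,
    hoff, card_wordsWith p N n hN, smul_eq_mul, smul_eq_mul] at hdc
  rw [mul_comm]
  exact hdc
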